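/- Let f : ℝⁿ × ℝᵐ → ℝⁿ, let u ∈ ℝᵐ be fixed, and let x1, x2 : [0,τ] → ℝⁿ be differentiable curves satisfying xi'(t) = f(xi(t), u) for all t ∈ [0,τ] (i = 1,2). Let V : ℝⁿ × ℝⁿ → ℝ be continuously differentiable, λ ∈ ℝ, and γ a class K∞ function such that for all z, z', z'' ∈ ℝⁿ: (a) ∂V/∂z1(z,z')·f(z,u) + ∂V/∂z2(z,z')·f(z',u) ≤ λ V(z,z'), and (b) V(z,z') − V(z,z'') ≤ γ(‖z'−z''‖). Then for every point w ∈ ℝⁿ, V(x1(τ), w) ≤ e^{λτ} V(x1(0), x2(0)) + γ(‖x2(τ) − w‖). -/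

import Mathlib

/-- A function `[0,∞) → [0,∞)` of class `K∞`: continuous, strictly increasing,
zero at zero, nonnegative and unbounded. -/
def ClassKInf (g : ℝ → ℝ) : Prop :=
  ContinuousOn g (Set.Ici 0) ∧ StrictMonoOn g (Set.Ici 0) ∧ g 0 = 0 ∧
  (∀ r ∈ Set.Ici (0 : ℝ), 0 ≤ g r) ∧ ∀ M : ℝ, ∃ r ∈ Set.Ici (0 : ℝ), M ≤ g r

/-- Comparison lemma: a function with `v' ≤ k v` on `[0, τ]` satisfies `v τ ≤ exp (k τ) * v 0`. -/
theorem le_exp_mul_of_hasDerivAt_le_mul {v v' : ℝ → ℝ} {k τ : ℝ} (hτ : 0 ≤ τ)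
    (hv : ∀ t ∈ Set.Icc (0 : ℝ) τ, HasDerivAt v (v' t) t)
    (hle : ∀ t ∈ Set.Icc (0 : ℝ) τ, v' t ≤ k * v t) :
    v τ ≤ Real.exp (k * τ) * v 0 := by
  have h := le_gronwallBound_of_liminf_deriv_right_le (f := v) (f' := v') (δ := v 0) (K := k)
    (ε := 0) (a := 0) (b := τ) (fun t ht => (hv t ht).continuousAt.continuousWithinAt)
    (fun t ht r hr => (hv t (Set.Ico_subset_Icc_self ht)).hasDerivWithinAt.liminf_right_slope_le hr)
    le_rfl (fun t ht => by simpa using hle t (Set.Ico_subset_Icc_self ht)) τ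
    (Set.right_mem_Icc.2 hτ)
  rwa [gronwallBound_ε0, sub_zero, mul_comm] at h

/-- if `x1, x2` are trajectories of `ẋ = f(x,u)` (same constant
input `u`) on `[0,τ]`, `V` is continuously differentiable, satisfies (a) the
Lyapunov differential inequality with rate `λ`, and (b)
`V(z,z') - V(z,z'') ≤ γ(‖z'-z''‖)` for a class `K∞` function `γ` (infinity
norm), then for every point `w`,
`V(x1(τ), w) ≤ e^{λτ} V(x1(0), x2(0)) + γ(‖x2(τ) - w‖)`. -/
theorem lyapunov_chain_of_inequalities {n m : ℕ}
    (f : (Fin n → ℝ) → (Fin m → ℝ) → (Fin n → ℝ)) (u : Fin m → ℝ)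
    (τ : ℝ) (hτ : 0 ≤ τ) (x1 x2 : ℝ → (Fin n → ℝ))
    (hx1 : ∀ t ∈ Set.Icc (0 : ℝ) τ, HasDerivAt x1 (f (x1 t) u) t)
    (hx2 : ∀ t ∈ Set.Icc (0 : ℝ) τ, HasDerivAt x2 (f (x2 t) u) t)
    (V : (Fin n → ℝ) × (Fin n → ℝ) → ℝ) (hV : ContDiff ℝ 1 V) (lam : ℝ)
    (gam : ℝ → ℝ) (hgam : ClassKInf gam)
    (ha : ∀ z1 z2 : Fin n → ℝ,
      fderiv ℝ V (z1, z2) (f z1 u, f z2 u) ≤ lam * V (z1, z2))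
    (hb : ∀ z z' z'' : Fin n → ℝ, V (z, z') - V (z, z'') ≤ gam ‖z' - z''‖) :
    ∀ w : Fin n → ℝ,
      V (x1 τ, w) ≤ Real.exp (lam * τ) * V (x1 0, x2 0) + gam ‖x2 τ - w‖ := by
  intro w
  have hdecay := le_exp_mul_of_hasDerivAt_le_mul (v := fun t => V (x1 t, x2 t)) (k := lam) hτ
    (fun t ht => ((hV.differentiable one_ne_zero) (x1 t, x2 t)).hasFDerivAt.comp_hasDerivAt t
      ((hx1 t ht).prodMk (hx2 t ht)))
    (fun t _ => ha (x1 t) (x2 t))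
  have hgap := hb (x1 τ) w (x2 τ)
  rw [norm_sub_rev] at hgap
  linarith
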